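/- arXiv:2505.19904 — 3 statements merged into one kernel-verified Lean document; each statement's English description precedes it below -/
import Mathlib

section
/- Let H be a bounded self-adjoint operator on a complex Hilbert space, {P_k}_{k=1,…,m} a complete orthogonal family of projections, and Ω an invertible bounded operator such that Ω†Ω commutes with every P_k and such that H_Bloch = Ω^{−1} H Ω commutes with every P_k. Let W = Ω (Ω†Ω)^{−1/2}. Then the Schrieffer–Wolff effective generator H_SW = W† H W is self-adjoint, satisfies H_SW = (Ω†Ω)^{1/2} H_Bloch (Ω†Ω)^{−1/2}, and commutes with every P_k. -/
open ContinuousLinearMap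

/-- **The Schrieffer–Wolff effective generator.**
Let `Hop` be bounded self-adjoint, `{P k}` a complete orthogonal family of projections, and
`Ω` an invertible bounded operator such that `Ω†Ω` and `H_Bloch = Ω⁻¹ Hop Ω` commute with
every `P k`. With `W = Ω (Ω†Ω)^{-1/2}`, the Schrieffer–Wolff generator `H_SW = W† Hop W`
is self-adjoint, equals `(Ω†Ω)^{1/2} H_Bloch (Ω†Ω)^{-1/2}`, and commutes with every `P k`. -/
theorem sw_generator_selfAdjoint_and_block_diagonal
    {𝓗 : Type*} [NormedAddCommGroup 𝓗] [InnerProductSpace ℂ 𝓗] [CompleteSpace 𝓗]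
    (m : ℕ) (Hop : 𝓗 →L[ℂ] 𝓗) (hH : IsSelfAdjoint Hop)
    (P : Fin m → 𝓗 →L[ℂ] 𝓗)
    (hP_adj : ∀ k, adjoint (P k) = P k)
    (hP_mul : ∀ k l, P k * P l = if k = l then P k else 0)
    (hP_sum : ∑ k, P k = 1)
    (Ω : 𝓗 →L[ℂ] 𝓗) (hΩ : IsUnit Ω)
    (hΩΩcomm : ∀ k, (adjoint Ω * Ω) * P k = P k * (adjoint Ω * Ω))
    (HBloch : 𝓗 →L[ℂ] 𝓗) (hHBloch : HBloch = Ring.inverse Ω * Hop * Ω)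
    (hHBlochcomm : ∀ k, HBloch * P k = P k * HBloch)
    (W : 𝓗 →L[ℂ] 𝓗) (hW : W = Ω * Ring.inverse (CFC.sqrt (adjoint Ω * Ω)))
    (HSW : 𝓗 →L[ℂ] 𝓗) (hHSW : HSW = adjoint W * Hop * W) :
    IsSelfAdjoint HSW ∧
    HSW = CFC.sqrt (adjoint Ω * Ω) * HBloch * Ring.inverse (CFC.sqrt (adjoint Ω * Ω)) ∧
    ∀ k, HSW * P k = P k * HSW := by
  rw [← star_eq_adjoint] at *
  set S := CFC.sqrt (star Ω * Ω) with hS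
  have hSS : S * S = star Ω * Ω := CFC.sqrt_mul_sqrt_self _ (star_mul_self_nonneg Ω)
  have hSunit : IsUnit S :=
    (CFC.isUnit_sqrt_iff _ (star_mul_self_nonneg Ω)).2 (hΩ.star.mul hΩ)
  have hSsa : star S = S := (CFC.sqrt_nonneg (star Ω * Ω)).isSelfAdjoint.star_eq
  have hScomm (k : Fin m) : Commute S (P k) := by
    rw [hS, CFC.sqrt_eq_cfc]
    exact Commute.cfc_nnreal (hΩΩcomm k) _
  have hSinv_comm (k : Fin m) : Commute (Ring.inverse S) (P k) := by
    rw [Ring.inverse_of_isUnit hSunit]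
    exact Commute.units_inv_left (u := hSunit.unit) (hScomm k)
  have hWstar : star W = S * Ring.inverse Ω := by
    rw [hW, star_mul, ← Ring.inverse_star, hSsa]
    calc Ring.inverse S * star Ω
        = Ring.inverse S * (star Ω * Ω) * Ring.inverse Ω := by
          rw [mul_assoc, mul_assoc, Ring.mul_inverse_cancel _ hΩ, mul_one]
      _ = S * Ring.inverse Ω := by
          rw [← hSS, ← mul_assoc, Ring.inverse_mul_cancel _ hSunit, one_mul]
  have hHSW_eq : HSW = S * HBloch * Ring.inverse S := by
    rw [hHSW, hWstar, hW, hHBloch]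
    simp only [mul_assoc]
  refine ⟨hHSW ▸ hH.conjugate' W, hHSW_eq, fun k => ?_⟩
  rw [hHSW_eq]
  exact ((hScomm k).mul_left (hHBlochcomm k)).mul_left (hSinv_comm k)
end

section
/- Let Ω be a bounded operator on a complex Hilbert space with ‖Ω − 1‖ ≤ δ for some δ with 0 ≤ δ < √2 − 1. Then Ω is invertible, Ω†Ω is positive and invertible, and the following bounds hold: ‖Ω†Ω − 1‖ ≤ 2δ + δ², ‖(Ω†Ω)^{−1/2}‖ ≤ (1 − 2δ − δ²)^{−1/2}, and ‖(Ω†Ω)^{−1/2} − 1‖ ≤ (1 − 2δ − δ²)^{−1/2} − 1. -/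
open ContinuousLinearMap

/-- If `a` is within `ε` of `1`, then so is its real spectrum. -/
lemma abs_sub_one_le_of_mem_spectrum {A : Type*} [CStarAlgebra A] {a : A}
    (ha : IsSelfAdjoint a) {ε : ℝ} (h : ‖a - 1‖ ≤ ε) {x : ℝ} (hx : x ∈ spectrum ℝ a) :
    |x - 1| ≤ ε := by
  have hcfc : cfc (fun y : ℝ ↦ y - 1) a = a - 1 := by
    rw [cfc_sub (fun y : ℝ ↦ y) (fun _ ↦ 1) a, cfc_id' ℝ a, cfc_const_one ℝ a]
  have := norm_apply_le_norm_cfc (fun y : ℝ ↦ y - 1) a hx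
  rw [hcfc, Real.norm_eq_abs] at this
  exact this.trans h

lemma abs_inv_sqrt_sub_one_le {ε x : ℝ} (hε : ε < 1) (hx : |x - 1| ≤ ε) :
    |(√x)⁻¹ - 1| ≤ (√(1 - ε))⁻¹ - 1 := by
  obtain ⟨hl, hr⟩ := abs_le.mp hx
  have hv : 0 < √(1 - ε) := Real.sqrt_pos.2 (by linarith)
  have hu : 0 < √x := Real.sqrt_pos.2 (by linarith)
  have hle : (√x)⁻¹ ≤ (√(1 - ε))⁻¹ := inv_anti₀ hv (Real.sqrt_le_sqrt (by linarith))
  have hprod : 1 ≤ (√x)⁻¹ * (√(1 - ε))⁻¹ := by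
    rw [← mul_inv, ← Real.sqrt_mul (by linarith)]
    refine (one_le_inv₀ (Real.sqrt_pos.2 (mul_pos (by linarith) (by linarith)))).2 ?_
    exact Real.sqrt_le_one.2 (by nlinarith)
  rw [abs_le]
  constructor
  · nlinarith [sq_nonneg ((√x)⁻¹ - (√(1 - ε))⁻¹), inv_pos.2 hv, inv_pos.2 hu]
  · linarith

/-- The inverse square root of a positive element at distance less than `1` from `1`. -/
lemma inverse_sqrt_eq_cfc {A : Type*} [CStarAlgebra A] [PartialOrder A] [StarOrderedRing A]
    {a : A} (ha : 0 ≤ a) {ε : ℝ} (hε : ε < 1) (h : ‖a - 1‖ ≤ ε) :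
    Ring.inverse (CFC.sqrt a) = cfc (fun x : ℝ ↦ (√x)⁻¹) a := by
  rw [CFC.sqrt_eq_real_sqrt a, cfcₙ_eq_cfc, cfc_inv Real.sqrt a]
  intro x hx
  have := abs_le.mp (abs_sub_one_le_of_mem_spectrum ha.isSelfAdjoint h hx)
  exact (Real.sqrt_pos.2 (by linarith)).ne'

lemma norm_inverse_sqrt_sub_one_le {A : Type*} [CStarAlgebra A] [PartialOrder A]
    [StarOrderedRing A] {a : A} (ha : 0 ≤ a) {ε : ℝ} (hε : ε < 1) (h : ‖a - 1‖ ≤ ε) :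
    ‖Ring.inverse (CFC.sqrt a) - 1‖ ≤ (√(1 - ε))⁻¹ - 1 := by
  have hsa : IsSelfAdjoint a := ha.isSelfAdjoint
  have hcont : ContinuousOn (fun x : ℝ ↦ (√x)⁻¹) (spectrum ℝ a) := by
    refine Real.continuous_sqrt.continuousOn.inv₀ fun x hx ↦ ?_
    have := abs_le.mp (abs_sub_one_le_of_mem_spectrum hsa h hx)
    exact (Real.sqrt_pos.2 (by linarith)).ne'
  rw [inverse_sqrt_eq_cfc ha hε h, ← cfc_const_one ℝ a, ← cfc_sub _ _ a hcont]
  refine norm_cfc_le ?_ fun x hx ↦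
    abs_inv_sqrt_sub_one_le hε (abs_sub_one_le_of_mem_spectrum hsa h hx)
  have hε0 : 0 ≤ ε := (norm_nonneg _).trans h
  exact sub_nonneg.2 ((one_le_inv₀ (Real.sqrt_pos.2 (by linarith))).2
    (Real.sqrt_le_one.2 (by linarith)))

lemma norm_inverse_sqrt_le {A : Type*} [CStarAlgebra A] [PartialOrder A]
    [StarOrderedRing A] {a : A} (ha : 0 ≤ a) {ε : ℝ} (hε : ε < 1) (h : ‖a - 1‖ ≤ ε) :
    ‖Ring.inverse (CFC.sqrt a)‖ ≤ (√(1 - ε))⁻¹ := by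
  rw [inverse_sqrt_eq_cfc ha hε h]
  refine norm_cfc_le (by positivity) fun x hx ↦ ?_
  have := abs_le.mp (abs_sub_one_le_of_mem_spectrum ha.isSelfAdjoint h hx)
  rw [Real.norm_of_nonneg (by positivity)]
  exact inv_anti₀ (Real.sqrt_pos.2 (by linarith)) (Real.sqrt_le_sqrt (by linarith))

lemma norm_star_mul_self_sub_one_le {A : Type*} [CStarAlgebra A] {a : A} {δ : ℝ}
    (h : ‖a - 1‖ ≤ δ) : ‖star a * a - 1‖ ≤ 2 * δ + δ ^ 2 := by
  have hδ : 0 ≤ δ := (norm_nonneg _).trans h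
  have heq : star a * a - 1 = star (a - 1) * (a - 1) + (star (a - 1) + (a - 1)) := by
    simp only [star_sub, star_one]
    noncomm_ring
  calc ‖star a * a - 1‖
      ≤ ‖star (a - 1) * (a - 1)‖ + (‖star (a - 1)‖ + ‖a - 1‖) := by
        rw [heq]
        exact (norm_add_le _ _).trans (by gcongr; exact norm_add_le _ _)
    _ = ‖a - 1‖ * ‖a - 1‖ + (‖a - 1‖ + ‖a - 1‖) := by
        rw [CStarRing.norm_star_mul_self, norm_star]
    _ ≤ δ * δ + (δ + δ) := by gcongr
    _ = 2 * δ + δ ^ 2 := by ring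

lemma isUnit_of_norm_sub_one_lt_one {R : Type*} [NormedRing R] [CompleteSpace R] {x : R}
    (h : ‖x - 1‖ < 1) : IsUnit x := by
  rw [norm_sub_rev] at h
  simpa using isUnit_one_sub_of_norm_lt_one h

/-- **Bounds on `Ω†Ω` and its inverse square root.**
If `‖Ω - 1‖ ≤ δ` with `0 ≤ δ < √2 - 1`, then `Ω` is invertible, `Ω†Ω` is positive and
invertible, `‖Ω†Ω - 1‖ ≤ 2δ + δ²`, `‖(Ω†Ω)^{-1/2}‖ ≤ (1 - 2δ - δ²)^{-1/2}`, and
`‖(Ω†Ω)^{-1/2} - 1‖ ≤ (1 - 2δ - δ²)^{-1/2} - 1`. -/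
theorem omega_dagger_omega_bounds
    {𝓗 : Type*} [NormedAddCommGroup 𝓗] [InnerProductSpace ℂ 𝓗] [CompleteSpace 𝓗]
    (Ω : 𝓗 →L[ℂ] 𝓗) (δ : ℝ) (hδ0 : 0 ≤ δ) (hδ : δ < Real.sqrt 2 - 1)
    (hΩ : ‖Ω - 1‖ ≤ δ) :
    IsUnit Ω ∧ 0 ≤ adjoint Ω * Ω ∧ IsUnit (adjoint Ω * Ω) ∧
    ‖adjoint Ω * Ω - 1‖ ≤ 2 * δ + δ ^ 2 ∧
    ‖Ring.inverse (CFC.sqrt (adjoint Ω * Ω))‖ ≤ (Real.sqrt (1 - 2 * δ - δ ^ 2))⁻¹ ∧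
    ‖Ring.inverse (CFC.sqrt (adjoint Ω * Ω)) - 1‖ ≤ (Real.sqrt (1 - 2 * δ - δ ^ 2))⁻¹ - 1 := by
  have hε : 2 * δ + δ ^ 2 < 1 := by
    nlinarith [Real.sq_sqrt (show (0 : ℝ) ≤ 2 by norm_num), Real.sqrt_nonneg 2]
  have hnonneg : 0 ≤ adjoint Ω * Ω := star_mul_self_nonneg Ω
  have hnorm : ‖adjoint Ω * Ω - 1‖ ≤ 2 * δ + δ ^ 2 := norm_star_mul_self_sub_one_le hΩ
  rw [sub_sub]
  exact ⟨isUnit_of_norm_sub_one_lt_one (hΩ.trans_lt (by nlinarith)), hnonneg,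
    isUnit_of_norm_sub_one_lt_one (hnorm.trans_lt hε), hnorm,
    norm_inverse_sqrt_le hnonneg hε hnorm, norm_inverse_sqrt_sub_one_le hnonneg hε hnorm⟩
end

section
/- Let Ω be a bounded operator on a complex Hilbert space with ‖Ω − 1‖ ≤ δ for some δ with 0 ≤ δ < √2 − 1, and let W = Ω (Ω†Ω)^{−1/2}. Then ‖W − 1‖ ≤ (1 + δ)/√(1 − 2δ − δ²) − 1. -/
open ContinuousLinearMap

/-- The real spectrum of an operator `T` lies within distance `‖T - 1‖` of `1`. -/
lemma abs_sub_one_le_of_mem_spectrum_s15 {𝓗 : Type*} [NormedAddCommGroup 𝓗]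
    [InnerProductSpace ℂ 𝓗] [CompleteSpace 𝓗] {T : 𝓗 →L[ℂ] 𝓗} {x : ℝ}
    (hx : x ∈ spectrum ℝ T) : |x - 1| ≤ ‖T - 1‖ := by
  have hmem : x - 1 ∈ spectrum ℝ (T - 1) := by
    have h := Set.sub_mem_sub hx (Set.mem_singleton (1 : ℝ))
    rwa [spectrum.sub_singleton_eq, map_one] at h
  calc |x - 1| ≤ ‖T - 1‖ * ‖(1 : 𝓗 →L[ℂ] 𝓗)‖ := spectrum.norm_le_norm_mul_of_mem hmem
    _ ≤ ‖T - 1‖ := mul_le_of_le_one_right (norm_nonneg _) norm_id_le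

/-- The inverse square root of a strictly positive operator as a continuous function of it. -/
lemma inverse_sqrt_eq_cfc_s15 {𝓗 : Type*} [NormedAddCommGroup 𝓗]
    [InnerProductSpace ℂ 𝓗] [CompleteSpace 𝓗] {T : 𝓗 →L[ℂ] 𝓗} (hT : 0 ≤ T)
    (hpos : ∀ x ∈ spectrum ℝ T, 0 < x) :
    Ring.inverse (CFC.sqrt T) = cfc (fun x : ℝ ↦ (√x)⁻¹) T := by
  have hsa : IsSelfAdjoint T := .of_nonneg hT
  rw [CFC.sqrt_eq_real_sqrt T hT, cfcₙ_eq_cfc]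
  exact (cfc_inv Real.sqrt T (fun x hx ↦ (Real.sqrt_pos.mpr (hpos x hx)).ne')).symm

/-- **Distance of the Schrieffer–Wolff transformation from the identity.**
If `‖Ω - 1‖ ≤ δ` with `0 ≤ δ < √2 - 1` (so that `Ω`, and hence `Ω†Ω`, is invertible), then
`W = Ω (Ω†Ω)^{-1/2}` satisfies `‖W - 1‖ ≤ (1 + δ)/√(1 - 2δ - δ²) - 1`. -/
theorem sw_transformation_close_to_identity
    {𝓗 : Type*} [NormedAddCommGroup 𝓗] [InnerProductSpace ℂ 𝓗] [CompleteSpace 𝓗]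
    (Ω : 𝓗 →L[ℂ] 𝓗) (δ : ℝ) (hδ0 : 0 ≤ δ) (hδ : δ < Real.sqrt 2 - 1)
    (hΩ : ‖Ω - 1‖ ≤ δ) :
    ‖Ω * Ring.inverse (CFC.sqrt (adjoint Ω * Ω)) - 1‖ ≤
      (1 + δ) / Real.sqrt (1 - 2 * δ - δ ^ 2) - 1 := by
  have hε : 2 * δ + δ ^ 2 < 1 := by
    nlinarith [Real.sq_sqrt (show (0 : ℝ) ≤ 2 by norm_num), Real.sqrt_nonneg 2]
  have hstar : ‖star (Ω - 1)‖ ≤ δ := (norm_star _).trans_le hΩ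
  rw [← star_eq_adjoint]
  have hT : 0 ≤ star Ω * Ω := star_mul_self_nonneg Ω
  have hT1 : ‖star Ω * Ω - 1‖ ≤ 2 * δ + δ ^ 2 := by
    have heq : star Ω * Ω - 1 = star (Ω - 1) * (Ω - 1) + (star (Ω - 1) + (Ω - 1)) := by
      simp only [star_sub, star_one]
      noncomm_ring
    calc ‖star Ω * Ω - 1‖
        ≤ ‖star (Ω - 1)‖ * ‖Ω - 1‖ + (‖star (Ω - 1)‖ + ‖Ω - 1‖) := by
          rw [heq]
          exact (norm_add_le _ _).trans (add_le_add (norm_mul_le _ _) (norm_add_le _ _))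
      _ ≤ δ * δ + (δ + δ) := by gcongr
      _ = 2 * δ + δ ^ 2 := by ring
  generalize star Ω * Ω = T at *
  have hsa : IsSelfAdjoint T := .of_nonneg hT
  have hspec : ∀ x ∈ spectrum ℝ T, |x - 1| ≤ 2 * δ + δ ^ 2 := fun x hx ↦
    (abs_sub_one_le_of_mem_spectrum_s15 hx).trans hT1
  have hpos : ∀ x ∈ spectrum ℝ T, 0 < x := fun x hx ↦ by
    linarith [(abs_le.mp (hspec x hx)).1]
  have hbound : ∀ x ∈ spectrum ℝ T,
      |(√x)⁻¹ - 1| ≤ (√(1 - (2 * δ + δ ^ 2)))⁻¹ - 1 := fun x hx ↦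
    abs_inv_sqrt_sub_one_le hε (hspec x hx)
  have hcont : ContinuousOn (fun x : ℝ ↦ (√x)⁻¹) (spectrum ℝ T) :=
    Real.continuous_sqrt.continuousOn.inv₀ fun x hx ↦ (Real.sqrt_pos.mpr (hpos x hx)).ne'
  rw [inverse_sqrt_eq_cfc_s15 hT hpos, sub_sub]
  set S := cfc (fun x : ℝ ↦ (√x)⁻¹) T with hS
  set k := (√(1 - (2 * δ + δ ^ 2)))⁻¹ with hk
  have hk1 : 1 ≤ k := by
    refine (one_le_inv₀ (Real.sqrt_pos.mpr (by linarith))).mpr ?_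
    exact Real.sqrt_le_one.mpr (by nlinarith)
  have hS_norm : ‖S‖ ≤ k := norm_cfc_le (by linarith) fun x hx ↦ by
    rw [Real.norm_of_nonneg (by positivity)]
    linarith [(abs_le.mp (hbound x hx)).2]
  have hS_sub : ‖S - 1‖ ≤ k - 1 := by
    rw [hS, ← cfc_one ℝ T, ← cfc_sub _ _ T hcont]
    exact norm_cfc_le (by linarith) hbound
  calc ‖Ω * S - 1‖ = ‖(Ω - 1) * S + (S - 1)‖ := by congr 1; noncomm_ring
    _ ≤ ‖Ω - 1‖ * ‖S‖ + ‖S - 1‖ := (norm_add_le _ _).trans (by gcongr; exact norm_mul_le _ _)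
    _ ≤ δ * k + (k - 1) := by gcongr
    _ = (1 + δ) / √(1 - (2 * δ + δ ^ 2)) - 1 := by rw [hk, div_eq_mul_inv]; ring
end
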